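/- Let G be a finite simple graph on vertex set {1,…,n} with edge set E, let K ∈ 𝒦(G), let 𝒫_n = {(i,j) : 1 ≤ i < j ≤ n} with N = n(n−1)/2, and let K̃_P be the N×N principal submatrix of the Kronecker product K⊗K whose rows and columns are indexed by the pairs in 𝒫_n. Let C > 0, p ∈ [0, 1/2], and let γ = (γ_1, …, γ_N) be independent random variables each taking the value 1 with probability p, the value −1 with probability p, and the value 0 with probability 1−2p. Then (1/N) · E[ sup_{β ∈ ℝ^N, ‖β‖_∞ ≤ C} βᵀ K̃_P γ ] ≤ C · λ1(K) · √(2p). -/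

import Mathlib

noncomputable section
open Finset Matrix Kronecker

/-- The three possible outcomes of a transductive-Rademacher variable have
probabilities `p`, `p`, `1 - 2p` ... -/
def radW (p : ℝ) : Fin 3 → ℝ := ![p, p, 1 - 2 * p]

/-- ... and values `1`, `-1`, `0` respectively. -/
def radV : Fin 3 → ℝ := ![1, -1, 0]

/-- Expectation of `h γ` where `γ = (γ_1, …, γ_N)` (indexed by `ι`) is a vector of i.i.d.
random variables taking value `1` w.p. `p`, `-1` w.p. `p` and `0` w.p. `1 - 2p`. -/
def radExp {ι : Type*} [Fintype ι] [DecidableEq ι] (p : ℝ) (h : (ι → ℝ) → ℝ) : ℝ :=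
  ∑ g : ι → Fin 3, (∏ k, radW p (g k)) * h (fun k => radV (g k))


-- The largest eigenvalue of a real symmetric matrix
-- (junk value `0` if the matrix is not symmetric).
open scoped Classical in
noncomputable def lam1 {ι : Type*} [Fintype ι] [DecidableEq ι] (M : Matrix ι ι ℝ) : ℝ :=
  if h : M.IsHermitian then ⨆ i, h.eigenvalues i else 0

/-- `𝒦(G)`: the set of symmetric PSD matrices with unit diagonal whose
off-diagonal entries vanish on non-edges of `G` (Gram matrices of orthonormal
representations of `G`). -/
def gramSet {n : ℕ} (G : SimpleGraph (Fin n)) : Set (Matrix (Fin n) (Fin n) ℝ) :=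
  {K | K.PosSemidef ∧ (∀ i, K i i = 1) ∧ ∀ i j, i ≠ j → ¬ G.Adj i j → K i j = 0}

/-- `𝒫_n`: the set of pairs `(i, j)` with `1 ≤ i < j ≤ n`. -/
abbrev Pairs (n : ℕ) := {q : Fin n × Fin n // q.1 < q.2}

lemma radW_nonneg {p : ℝ} (hp0 : 0 ≤ p) (hp : p ≤ 1 / 2) (x : Fin 3) : 0 ≤ radW p x := by
  fin_cases x
  · simpa [radW] using hp0
  · simpa [radW] using hp0
  · simp [radW]; linarith

section RadExp

variable {ι : Type*} [Fintype ι] [DecidableEq ι] {p : ℝ}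

lemma radExp_mono (hp0 : 0 ≤ p) (hp : p ≤ 1 / 2) {f h : (ι → ℝ) → ℝ} (hfh : ∀ γ, f γ ≤ h γ) :
    radExp p f ≤ radExp p h :=
  sum_le_sum fun _ _ =>
    mul_le_mul_of_nonneg_left (hfh _) (prod_nonneg fun _ _ => radW_nonneg hp0 hp _)

lemma radExp_const_mul (c : ℝ) (h : (ι → ℝ) → ℝ) :
    radExp p (fun γ => c * h γ) = c * radExp p h := by
  simp only [radExp, mul_sum]
  exact sum_congr rfl fun _ _ => by ring

lemma radExp_sum {κ : Type*} (s : Finset κ) (h : κ → (ι → ℝ) → ℝ) :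
    radExp p (fun γ => ∑ k ∈ s, h k γ) = ∑ k ∈ s, radExp p (h k) := by
  simp only [radExp, mul_sum]
  exact sum_comm

/-- Independence: the expectation of a product of functions of the coordinates factors. -/
lemma radExp_prod (f : ι → ℝ → ℝ) :
    radExp p (fun γ => ∏ k, f k (γ k)) = ∏ k, ∑ x, radW p x * f k (radV x) := by
  simp only [radExp, ← prod_mul_distrib]
  rw [prod_univ_sum, Fintype.piFinset_univ]

lemma radExp_one : radExp p (fun _ : ι → ℝ => 1) = 1 := by
  have h := radExp_prod (ι := ι) (p := p) fun _ _ => 1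
  simp only [prod_const_one] at h
  rw [h]
  refine prod_eq_one fun _ _ => ?_
  simp [Fin.sum_univ_three, radW]; ring

/-- Distinct coordinates are uncorrelated, and each has variance `2 p`. -/
lemma radExp_mul (l m : ι) :
    radExp p (fun γ => γ l * γ m) = if l = m then 2 * p else 0 := by
  have h := radExp_prod (p := p) fun k (x : ℝ) =>
    (if k = l then x else 1) * (if k = m then x else 1)
  simp only [prod_mul_distrib, prod_ite_eq', mem_univ, if_true] at h
  rw [h]
  split_ifs with hlm
  · subst hlm
    rw [prod_eq_single l]
    · simp [Fin.sum_univ_three, radW, radV]; ring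
    · intro k _ hk
      simp [Fin.sum_univ_three, radW, hk]; ring
    · simp
  · refine prod_eq_zero (mem_univ l) ?_
    simp [Fin.sum_univ_three, radW, radV, hlm]

lemma radExp_dotProduct_sq (a : ι → ℝ) :
    radExp p (fun γ => (a ⬝ᵥ γ) ^ 2) = 2 * p * ∑ l, a l ^ 2 := by
  have h : (fun γ : ι → ℝ => (a ⬝ᵥ γ) ^ 2)
      = fun γ => ∑ l, ∑ m, (a l * a m) * (γ l * γ m) := by
    funext γ
    rw [sq, dotProduct, sum_mul_sum]
    exact sum_congr rfl fun _ _ => sum_congr rfl fun _ _ => by ring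
  rw [h]
  simp only [radExp_sum, radExp_const_mul, radExp_mul, mul_ite, mul_zero, sum_ite_eq, mem_univ,
    if_true, mul_sum]
  exact sum_congr rfl fun _ _ => by ring

lemma radExp_sq_le (hp0 : 0 ≤ p) (hp : p ≤ 1 / 2) (h : (ι → ℝ) → ℝ) :
    radExp p h ^ 2 ≤ radExp p (fun γ => h γ ^ 2) := by
  have hw (g : ι → Fin 3) : 0 ≤ ∏ k, radW p (g k) := prod_nonneg fun _ _ => radW_nonneg hp0 hp _
  have hcs := sum_sq_le_sum_mul_sum_of_sq_le_mul univ
    (r := fun g : ι → Fin 3 => (∏ k, radW p (g k)) * h (fun k => radV (g k)))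
    (f := fun g => ∏ k, radW p (g k))
    (g := fun g => (∏ k, radW p (g k)) * h (fun k => radV (g k)) ^ 2)
    (fun g _ => hw g) (fun g _ => mul_nonneg (hw g) (sq_nonneg _)) (fun g _ => (by ring : _ = _).le)
  have h1 : ∑ g : ι → Fin 3, ∏ k, radW p (g k) = 1 := by
    simpa [radExp] using radExp_one (ι := ι) (p := p)
  rwa [h1, one_mul] at hcs

lemma radExp_abs_dotProduct_le (hp0 : 0 ≤ p) (hp : p ≤ 1 / 2) (a : ι → ℝ) :
    radExp p (fun γ => |a ⬝ᵥ γ|) ≤ √(2 * p * ∑ l, a l ^ 2) := by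
  refine Real.le_sqrt_of_sq_le ((radExp_sq_le hp0 hp _).trans_eq ?_)
  simp only [sq_abs, radExp_dotProduct_sq]

end RadExp

section LargestEigenvalue

variable {ι : Type*} [Fintype ι] [DecidableEq ι] {K : Matrix ι ι ℝ}

lemma lam1_nonneg (hK : K.PosSemidef) : 0 ≤ lam1 K := by
  rw [lam1, dif_pos hK.isHermitian]
  exact Real.iSup_nonneg hK.eigenvalues_nonneg

lemma sum_row_sq_le_lam1_mul (hK : K.PosSemidef) (i : ι) :
    ∑ j, K i j ^ 2 ≤ lam1 K * K i i := by
  have hH := hK.isHermitian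
  let U : Matrix ι ι ℝ := hH.eigenvectorUnitary
  let d := hH.eigenvalues
  have hspec : K = U * diagonal d * star U := by
    simpa [Unitary.conjStarAlgAut_apply, Function.comp_def] using hH.spectral_theorem
  have hUU : star U * U = 1 := Unitary.coe_star_mul_self hH.eigenvectorUnitary
  have hsq : K * K = U * diagonal (fun k => d k * d k) * star U := by
    rw [← diagonal_mul_diagonal]
    calc K * K = U * diagonal d * (star U * U) * diagonal d * star U := by
          nth_rewrite 1 2 [hspec]; simp only [Matrix.mul_assoc]
      _ = _ := by rw [hUU]; simp only [Matrix.mul_assoc, Matrix.one_mul]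
  have hentry (e : ι → ℝ) : (U * diagonal e * star U) i i = ∑ k, e k * U i k ^ 2 := by
    rw [Matrix.mul_apply]
    refine sum_congr rfl fun k _ => ?_
    simp [mul_diagonal, star_apply]; ring
  have hrow : ∑ j, K i j ^ 2 = (K * K) i i := by
    rw [Matrix.mul_apply]
    refine sum_congr rfl fun j _ => ?_
    rw [sq, ← hH.apply j i]; simp
  have hdiag : K i i = ∑ k, d k * U i k ^ 2 := by rw [← hentry d, ← hspec]
  rw [hrow, hsq, hentry, hdiag, mul_sum]
  refine sum_le_sum fun k _ => ?_
  have hle : d k ≤ lam1 K := by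
    rw [lam1, dif_pos hH]
    exact le_ciSup (Set.finite_range _).bddAbove k
  rw [← mul_assoc]
  gcongr
  exact hK.eigenvalues_nonneg k

lemma sum_pairs_kronecker_sq_le {n : ℕ} {K : Matrix (Fin n) (Fin n) ℝ} (hK : K.PosSemidef)
    (hdiag : ∀ i, K i i = 1) (k : Pairs n) :
    ∑ l : Pairs n, (K ⊗ₖ K) k.val l.val ^ 2 ≤ lam1 K ^ 2 := by
  have hrow (i : Fin n) : ∑ j, K i j ^ 2 ≤ lam1 K := by
    simpa [hdiag] using sum_row_sq_le_lam1_mul hK i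
  calc ∑ l : Pairs n, (K ⊗ₖ K) k.val l.val ^ 2
      ≤ ∑ q : Fin n × Fin n, (K ⊗ₖ K) k.val q ^ 2 := by
        rw [← sum_subtype (univ.filter fun q : Fin n × Fin n => q.1 < q.2) (by simp)
          (fun q => (K ⊗ₖ K) k.val q ^ 2)]
        exact sum_le_sum_of_subset_of_nonneg (subset_univ _) fun _ _ _ => sq_nonneg _
    _ = (∑ j, K k.val.1 j ^ 2) * ∑ j, K k.val.2 j ^ 2 := by
        rw [sum_mul_sum, Fintype.sum_prod_type]
        simp [kroneckerMap_apply, mul_pow]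
    _ ≤ lam1 K ^ 2 := by
        rw [sq]
        exact mul_le_mul (hrow _) (hrow _) (sum_nonneg fun _ _ => sq_nonneg _) (lam1_nonneg hK)

end LargestEigenvalue

lemma sSup_dotProduct_le {ι : Type*} [Fintype ι] {C : ℝ} (hC : 0 ≤ C) (v : ι → ℝ) :
    sSup {x : ℝ | ∃ β : ι → ℝ, (∀ k, |β k| ≤ C) ∧ x = β ⬝ᵥ v} ≤ C * ∑ k, |v k| := by
  refine Real.sSup_le ?_ (mul_nonneg hC (sum_nonneg fun _ _ => abs_nonneg _))
  rintro x ⟨β, hβ, rfl⟩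
  rw [dotProduct, mul_sum]
  refine sum_le_sum fun k _ => (le_abs_self _).trans ?_
  rw [abs_mul]
  exact mul_le_mul_of_nonneg_right (hβ k) (abs_nonneg _)

/-- for `K ∈ 𝒦(G)` and `K̃_P` the principal submatrix of `K ⊗ K`
indexed by the pairs `𝒫_n`, the transductive Rademacher complexity satisfies
`(1/N) E[sup_{‖β‖_∞ ≤ C} βᵀ K̃_P γ] ≤ C λ1(K) √(2p)`. -/
theorem stmt_6 (n : ℕ) (G : SimpleGraph (Fin n)) (K : Matrix (Fin n) (Fin n) ℝ)
    (hK : K ∈ gramSet G) (C p : ℝ) (hC : 0 < C) (hp0 : 0 ≤ p) (hp : p ≤ 1 / 2) :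
    (1 / (Fintype.card (Pairs n) : ℝ)) * radExp p (fun γ : Pairs n → ℝ =>
        sSup {x : ℝ | ∃ β : Pairs n → ℝ, (∀ k, |β k| ≤ C) ∧
          x = β ⬝ᵥ (((K ⊗ₖ K).submatrix (fun k : Pairs n => k.val)
                (fun k : Pairs n => k.val)) *ᵥ γ)})
      ≤ C * lam1 K * Real.sqrt (2 * p) := by
  obtain ⟨hpsd, hdiag, -⟩ := hK
  have hlam := lam1_nonneg hpsd
  set M := (K ⊗ₖ K).submatrix (fun k : Pairs n => k.val) (fun k : Pairs n => k.val) with hM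
  have hcoord (k : Pairs n) : radExp p (fun γ => |(M *ᵥ γ) k|) ≤ lam1 K * √(2 * p) := by
    refine (radExp_abs_dotProduct_le hp0 hp (M k)).trans ?_
    rw [Real.sqrt_mul (by positivity), mul_comm]
    gcongr
    exact Real.sqrt_le_iff.2 ⟨hlam, sum_pairs_kronecker_sq_le hpsd hdiag k⟩
  have htotal := (radExp_mono hp0 hp fun γ => sSup_dotProduct_le hC.le (M *ᵥ γ)).trans_eq
    ((radExp_const_mul C _).trans (congrArg _ (radExp_sum univ fun k γ => |(M *ᵥ γ) k|)))
  have hsum : ∑ k, radExp p (fun γ => |(M *ᵥ γ) k|)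
      ≤ Fintype.card (Pairs n) * (lam1 K * √(2 * p)) := by
    simpa using sum_le_card_nsmul univ _ _ fun k _ => hcoord k
  rw [one_div]
  rcases (Fintype.card (Pairs n)).eq_zero_or_pos with h0 | hpos
  · rw [h0, Nat.cast_zero, _root_.inv_zero, zero_mul]
    positivity
  · rw [inv_mul_le_iff₀ (by exact_mod_cast hpos)]
    refine (htotal.trans (mul_le_mul_of_nonneg_left hsum hC.le)).trans_eq ?_
    ring
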